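/- arXiv:2108.12687 — 4 statements merged into one kernel-verified Lean document; each statement's English description precedes it below -/
import Mathlib

section
/- For every fixed natural number t ≥ 2 there is a natural number n₀ such that for every n ≥ n₀ there exists a t-DRGP stencil H (of size tn × n) with visible rank vrk(H) ≤ 6·t²·ln n + 1. -/
noncomputable section

/-- A square stencil (Bool matrix, `true` = ⋆) is visibly full rank if it has a
unique generalized diagonal of ⋆'s. -/
def VisFullRank {α : Type*} (M : Matrix α α Bool) : Prop :=
  ∃! σ : Equiv.Perm α, ∀ i, M i (σ i) = true

/-- The visible rank of a stencil: the largest `k` admitting a `k × k`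
visibly full rank sub-stencil. -/
def vrk {α β : Type*} (H : Matrix α β Bool) : ℕ :=
  sSup {k : ℕ | ∃ r : Fin k → α, ∃ c : Fin k → β,
    Function.Injective r ∧ Function.Injective c ∧
    VisFullRank (Matrix.of fun i j => H (r i) (c j))}

/-- Tensor product of stencils. -/
def stTensor {α₁ β₁ α₂ β₂ : Type*} (H₁ : Matrix α₁ β₁ Bool) (H₂ : Matrix α₂ β₂ Bool) :
    Matrix (α₁ × α₂) (β₁ × β₂) Bool :=
  Matrix.of fun a b => H₁ a.1 b.1 && H₂ a.2 b.2

/-- `k`-th tensor power of a stencil. -/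
def stPow {α β : Type*} (H : Matrix α β Bool) (k : ℕ) :
    Matrix (Fin k → α) (Fin k → β) Bool :=
  Matrix.of fun r c => decide (∀ i, H (r i) (c i) = true)

/-- `W` is an `F`-witness of the stencil `H`. -/
def IsWitness {α β F : Type*} [Field F] (H : Matrix α β Bool) (W : Matrix α β F) : Prop :=
  ∀ i j, W i j ≠ 0 ↔ H i j = true

/-- The `F`-rank of a stencil: the minimum rank of an `F`-witness. -/
def frk (F : Type*) [Field F] {α β : Type*} [Fintype β] (H : Matrix α β Bool) : ℕ :=
  sInf {r : ℕ | ∃ W : Matrix α β F, IsWitness H W ∧ W.rank = r}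

/-- Every self-map of a finite type has a periodic point on each forward orbit. -/
theorem exists_iterate_mem_periodicPts {α : Type*} [Finite α] (g : α → α) (x : α) :
    ∃ m, g^[m] x ∈ Function.periodicPts g := by
  obtain ⟨p, q, hpq, h⟩ := Finite.exists_ne_map_eq_of_infinite (fun m => g^[m] x)
  wlog hlt : p < q generalizing p q
  · exact this q p hpq.symm h.symm (by omega)
  refine ⟨p, Function.mk_mem_periodicPts (n := q - p) (by omega) ?_⟩
  change g^[q - p] (g^[p] x) = g^[p] x
  rw [← Function.iterate_add_apply, Nat.sub_add_cancel hlt.le]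
  exact h.symm

/-- If `σ` is the only generalized diagonal of `M`, every nonempty set of rows contains a row
whose only star, among the columns matched to this set, is the diagonal one. -/
theorem exists_row_eq_false {α : Type*} [Finite α] {M : Matrix α α Bool} {σ : Equiv.Perm α}
    (hσ : ∀ i, M i (σ i) = true)
    (huniq : ∀ τ : Equiv.Perm α, (∀ i, M i (τ i) = true) → τ = σ)
    {T : Finset α} (hT : T.Nonempty) :
    ∃ a ∈ T, ∀ b ∈ T, b ≠ a → M a (σ b) = false := by
  classical
  by_contra! hcon
  choose! g hgT hgne hgM using hcon
  let G : α → α := fun a => if a ∈ T then g a else a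
  have hGT : ∀ a ∈ T, G a ∈ T := fun a ha => by simpa [G, ha] using hgT a ha
  have hGM : ∀ a, M a (σ (G a)) = true := fun a => by
    by_cases ha : a ∈ T
    · simpa [G, ha] using hgM a ha
    · simpa [G, ha] using hσ a
  have hbij := Function.bijOn_periodicPts G
  let π : α → α := fun x => if x ∈ Function.periodicPts G then G x else x
  have hπ : Function.Injective π := by
    intro x y hxy
    by_cases hx : x ∈ Function.periodicPts G <;> by_cases hy : y ∈ Function.periodicPts G <;>
      simp only [π, hx, hy, if_true, if_false] at hxy
    · exact hbij.injOn hx hy hxy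
    · exact absurd (hxy ▸ hbij.mapsTo hx) hy
    · exact absurd (hxy ▸ hbij.mapsTo hy) hx
    · exact hxy
  have hτ := huniq ((Equiv.ofBijective π (Finite.injective_iff_bijective.mp hπ)).trans σ)
    (fun i => by
      by_cases hi : i ∈ Function.periodicPts G
      · simpa [π, hi] using hGM i
      · simpa [π, hi] using hσ i)
  obtain ⟨x, hx⟩ := hT
  obtain ⟨m, hm⟩ := exists_iterate_mem_periodicPts G x
  have hmT : G^[m] x ∈ T := by
    clear hm
    induction m with
    | zero => exact hx
    | succ m ih => rw [Function.iterate_succ_apply']; exact hGT _ ih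
  have hfix : π (G^[m] x) = G^[m] x := by
    have h := congrArg (fun τ : Equiv.Perm α => τ (G^[m] x)) hτ
    exact σ.injective h
  simp only [π, hm, if_true] at hfix
  refine hgne _ hmT ?_
  simpa only [G, hmT, if_true] using hfix

/-- A stencil with a unique generalized diagonal is triangular, after a simultaneous reordering
of its rows and matched columns, on every set of rows. -/
theorem exists_triangular_order {α : Type*} [Finite α] {M : Matrix α α Bool} {σ : Equiv.Perm α}
    (hσ : ∀ i, M i (σ i) = true)
    (huniq : ∀ τ : Equiv.Perm α, (∀ i, M i (τ i) = true) → τ = σ)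
    (m : ℕ) (T : Finset α) (hT : T.card = m) :
    ∃ e : Fin m → α, Function.Injective e ∧ (∀ a, e a ∈ T) ∧
      ∀ a b, a < b → M (e a) (σ (e b)) = false := by
  classical
  induction m generalizing T with
  | zero => exact ⟨Fin.elim0, fun a => a.elim0, fun a => a.elim0, fun a => a.elim0⟩
  | succ m ih =>
    obtain ⟨x, hx, hxT⟩ := exists_row_eq_false hσ huniq (T := T) (Finset.card_pos.mp (by omega))
    obtain ⟨e, he, heT, htri⟩ := ih (T.erase x) (by rw [Finset.card_erase_of_mem hx, hT]; rfl)
    refine ⟨Fin.cons x e, Fin.cons_injective_iff.mpr ⟨?_, he⟩, ?_, ?_⟩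
    · rintro ⟨a, rfl⟩
      exact Finset.notMem_erase _ _ (heT a)
    · intro a
      refine Fin.cases hx (fun a => ?_) a
      exact Finset.mem_of_mem_erase (heT a)
    · intro a b
      refine Fin.cases ?_ (fun b => ?_) b
      · intro h
        exact absurd h (Fin.not_lt_zero a)
      · refine Fin.cases ?_ (fun a => ?_) a
        · intro _
          exact hxT _ (Finset.mem_of_mem_erase (heT b)) (Finset.ne_of_mem_erase (heT b))
        · intro h
          exact htri a b (Fin.succ_lt_succ_iff.mp h)

theorem two_mul_card_filter_lt (m : ℕ) :
    2 * ((Finset.univ.filter fun p : Fin m × Fin m => p.1 < p.2).card : ℝ) = m * (m - 1) := by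
  have h : (Finset.univ.filter fun p : Fin m × Fin m => p.1 < p.2).card
      = ∑ i ∈ Finset.range m, i := by
    rw [Finset.card_filter, Fintype.sum_prod_type_right, ← Fin.sum_univ_eq_sum_range (fun i => i)]
    refine Finset.sum_congr rfl fun b _ => ?_
    rw [← Finset.card_filter, ← Fin.card_Iio b]
    congr 1
    ext x
    simp
  have h2 := Finset.sum_range_id_mul_two m
  rw [h]
  rcases m with _ | m
  · simp
  · rw [Nat.add_sub_cancel] at h2
    have h3 : ((∑ i ∈ Finset.range (m + 1), i : ℕ) : ℝ) * 2 = (m + 1) * m := by exact_mod_cast h2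
    rw [mul_comm, h3]
    push_cast
    ring

/-- The number of functions to `Fin t` avoiding a prescribed value at every point of an
injectively indexed family. -/
theorem card_filter_forall_ne_le {κ ι : Type*} [Fintype κ] [DecidableEq κ]
    {t : ℕ} (ht : 0 < t) (P : Finset ι) (q : ι → κ) (hq : Set.InjOn q P) (v : ι → Fin t) :
    ((Finset.univ.filter fun f : κ → Fin t => ∀ p ∈ P, f (q p) ≠ v p).card : ℝ)
      ≤ (t : ℝ) ^ Fintype.card κ * (1 - 1 / (t : ℝ)) ^ P.card := by
  classical
  have ht' : (0 : ℝ) < t := by exact_mod_cast ht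
  let A : κ → Finset (Fin t) := fun x => Finset.univ.filter fun w => ∀ p ∈ P, q p = x → w ≠ v p
  have hsub : (Finset.univ.filter fun f : κ → Fin t => ∀ p ∈ P, f (q p) ≠ v p)
      ⊆ Fintype.piFinset A := by
    intro f hf
    simp only [Finset.mem_filter, Finset.mem_univ, true_and] at hf
    simp only [Fintype.mem_piFinset, A, Finset.mem_filter, Finset.mem_univ, true_and]
    rintro x p hp rfl
    exact hf p hp
  have hA : ∀ x, ((A x).card : ℝ) ≤ t * if x ∈ P.image q then 1 - 1 / (t : ℝ) else 1 := by
    intro x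
    split_ifs with hx
    · obtain ⟨p, hp, rfl⟩ := Finset.mem_image.mp hx
      have h : A (q p) ⊆ Finset.univ.erase (v p) := fun w hw =>
        Finset.mem_erase.mpr ⟨(Finset.mem_filter.mp hw).2 p hp rfl, Finset.mem_univ _⟩
      have h2 := Finset.card_le_card h
      rw [Finset.card_erase_of_mem (Finset.mem_univ _), Finset.card_fin] at h2
      have h3 : ((A (q p)).card : ℝ) + 1 ≤ t := by exact_mod_cast (by omega)
      have h4 : (t : ℝ) * (1 - 1 / t) = t - 1 := by field_simp
      linarith
    · have h2 := Finset.card_le_univ (A x)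
      rw [Fintype.card_fin] at h2
      rw [mul_one]
      exact_mod_cast h2
  calc ((Finset.univ.filter fun f : κ → Fin t => ∀ p ∈ P, f (q p) ≠ v p).card : ℝ)
      ≤ (Fintype.piFinset A).card := by exact_mod_cast Finset.card_le_card hsub
    _ = ∏ x, ((A x).card : ℝ) := by rw [Fintype.card_piFinset]; push_cast; rfl
    _ ≤ ∏ x, ((t : ℝ) * if x ∈ P.image q then 1 - 1 / (t : ℝ) else 1) :=
        Finset.prod_le_prod (fun _ _ => Nat.cast_nonneg _) fun x _ => hA x
    _ = _ := by
        rw [Finset.prod_mul_distrib, Finset.prod_const, Finset.card_univ, Fintype.prod_ite_mem,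
          Finset.prod_const, Finset.card_image_of_injOn hq]

/-- If there are few configurations, some function meets every triangular pattern of size `m`. -/
theorem exists_forall_hits {t n m : ℕ} (ht : 0 < t)
    (hlt : ((t : ℝ) * n ^ 2) ^ m * (1 - 1 / (t : ℝ)) ^
      (Finset.univ.filter fun p : Fin m × Fin m => p.1 < p.2).card < 1) :
    ∃ f : Fin n × Fin n → Fin t, ∀ (i : Fin m → Fin n) (j : Fin m → Fin t) (c : Fin m → Fin n),
      Function.Injective i → Function.Injective c → ∃ a b, a < b ∧ f (i a, c b) = j a := by
  classical
  by_contra! hcon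
  set P := Finset.univ.filter fun p : Fin m × Fin m => p.1 < p.2 with hP
  have ht' : (0 : ℝ) < t := by exact_mod_cast ht
  let C : Finset ((Fin m → Fin n) × (Fin m → Fin t) × (Fin m → Fin n)) :=
    Finset.univ.filter fun x => Function.Injective x.1 ∧ Function.Injective x.2.2
  let B : (Fin m → Fin n) × (Fin m → Fin t) × (Fin m → Fin n) →
      Finset (Fin n × Fin n → Fin t) := fun x =>
    Finset.univ.filter fun f => ∀ p ∈ P, f (x.1 p.1, x.2.2 p.2) ≠ x.2.1 p.1
  have hcover : (Finset.univ : Finset (Fin n × Fin n → Fin t)) ⊆ C.biUnion B := by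
    intro f _
    obtain ⟨i, j, c, hi, hc, h⟩ := hcon f
    refine Finset.mem_biUnion.mpr ⟨(i, j, c), by simp [C, hi, hc], ?_⟩
    simp only [B, hP, Finset.mem_filter, Finset.mem_univ, true_and]
    exact fun p hp => h p.1 p.2 hp
  have hB : ∀ x ∈ C, ((B x).card : ℝ) ≤ (t : ℝ) ^ (n * n) * (1 - 1 / (t : ℝ)) ^ P.card := by
    intro x hx
    obtain ⟨hi, hc⟩ := (Finset.mem_filter.mp hx).2
    have h := card_filter_forall_ne_le ht P (fun p => (x.1 p.1, x.2.2 p.2))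
      (fun p _ p' _ h => Prod.ext (hi (congrArg Prod.fst h)) (hc (congrArg Prod.snd h)))
      (fun p => x.2.1 p.1)
    rw [Fintype.card_prod, Fintype.card_fin] at h
    convert h
  have hC : (C.card : ℝ) ≤ ((t : ℝ) * n ^ 2) ^ m := by
    have h := Finset.card_le_univ C
    simp only [Fintype.card_prod, Fintype.card_fun, Fintype.card_fin] at h
    calc (C.card : ℝ) ≤ ((n ^ m * (t ^ m * n ^ m) : ℕ) : ℝ) := by exact_mod_cast h
      _ = _ := by push_cast; ring
  have h1 : (t : ℝ) ^ (n * n) ≤ ∑ x ∈ C, ((B x).card : ℝ) := by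
    have h := (Finset.card_le_card hcover).trans Finset.card_biUnion_le
    simp only [Finset.card_univ, Fintype.card_fun, Fintype.card_prod, Fintype.card_fin] at h
    exact_mod_cast h
  have hnonneg : (0 : ℝ) ≤ 1 - 1 / (t : ℝ) := by
    rw [sub_nonneg, div_le_one ht']
    exact_mod_cast ht
  have h2 : (t : ℝ) ^ (n * n) ≤
      ((t : ℝ) * n ^ 2) ^ m * ((t : ℝ) ^ (n * n) * (1 - 1 / (t : ℝ)) ^ P.card) := by
    refine h1.trans ((Finset.sum_le_sum hB).trans ?_)
    rw [Finset.sum_const, nsmul_eq_mul]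
    exact mul_le_mul_of_nonneg_right hC (by positivity)
  have h3 := mul_lt_mul_of_pos_left hlt (show (0 : ℝ) < (t : ℝ) ^ (n * n) by positivity)
  nlinarith

theorem pow_mul_pow_lt_one {t n : ℕ} (ht : 2 ≤ t) (hn : 3 * t ≤ n) {m : ℕ}
    (hm : m = ⌊6 * (t : ℝ) * Real.log n⌋₊ + 1) :
    ((t : ℝ) * n ^ 2) ^ m * (1 - 1 / (t : ℝ)) ^
      (Finset.univ.filter fun p : Fin m × Fin m => p.1 < p.2).card < 1 := by
  have hP := two_mul_card_filter_lt m
  set N := (Finset.univ.filter fun p : Fin m × Fin m => p.1 < p.2).card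
  have ht2 : (2 : ℝ) ≤ t := by exact_mod_cast ht
  have ht' : (0 : ℝ) < t := by linarith
  have hn3 : (3 : ℝ) * t ≤ n := by exact_mod_cast hn
  have hn' : (0 : ℝ) < n := by linarith
  have hm1 : 6 * (t : ℝ) * Real.log n < m := by
    rw [hm]
    exact_mod_cast Nat.lt_floor_add_one (6 * (t : ℝ) * Real.log n)
  have hm0 : (0 : ℝ) < m := by rw [hm]; positivity
  have hlog : Real.log t + 1 ≤ Real.log n := by
    have h3 : (1 : ℝ) ≤ Real.log 3 := by
      rw [Real.le_log_iff_exp_le (by norm_num)]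
      linarith [Real.exp_one_lt_d9]
    have h := Real.log_le_log (by positivity) hn3
    rw [Real.log_mul (by norm_num) ht'.ne'] at h
    linarith
  have hbase : (t : ℝ) * n ^ 2 = Real.exp (Real.log t + 2 * Real.log n) := by
    rw [Real.exp_add, Real.exp_log ht', two_mul, Real.exp_add, Real.exp_log hn']
    ring
  have hnonneg : (0 : ℝ) ≤ 1 - 1 / (t : ℝ) := by
    rw [sub_nonneg, div_le_one ht']
    linarith
  have hle : 1 - 1 / (t : ℝ) ≤ Real.exp (-(1 / (t : ℝ))) := by
    linarith [Real.add_one_le_exp (-(1 / (t : ℝ)))]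
  calc ((t : ℝ) * n ^ 2) ^ m * (1 - 1 / (t : ℝ)) ^ N
      ≤ ((t : ℝ) * n ^ 2) ^ m * Real.exp (-(1 / (t : ℝ))) ^ N := by gcongr
    _ = Real.exp (m * (Real.log t + 2 * Real.log n) - N / t) := by
        rw [hbase, ← Real.exp_nat_mul, ← Real.exp_nat_mul, ← Real.exp_add]
        congr 1
        ring
    _ < 1 := by
        rw [Real.exp_lt_one_iff, sub_neg, lt_div_iff₀ ht']
        have key : 2 * t * (Real.log t + 2 * Real.log n) < (m : ℝ) - 1 := by nlinarith
        nlinarith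

/-- A visibly full rank sub-stencil with rows indexed by pairs contains a large triangular
sub-stencil whose rows have pairwise distinct first coordinates. -/
theorem exists_triangular_of_visFullRank {ι γ : Type*} {t k m : ℕ} (H : Matrix (ι × Fin t) γ Bool)
    {r : Fin k → ι × Fin t} {c : Fin k → γ} (hr : Function.Injective r)
    (hc : Function.Injective c) (hM : VisFullRank (Matrix.of fun i j => H (r i) (c j)))
    (hm : t * m < k + t) :
    ∃ (i : Fin m → ι) (j : Fin m → Fin t) (d : Fin m → γ), Function.Injective i ∧
      Function.Injective d ∧ ∀ a b, a < b → H (i a, j a) (d b) = false := by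
  classical
  obtain ⟨σ, hσ, huniq⟩ := hM
  have hcard : k ≤ t * (Finset.univ.image fun x => (r x).1).card := by
    have h := Finset.card_le_mul_card_image (f := fun x => (r x).1)
      (Finset.univ : Finset (Fin k)) t (fun b _ => by
        have h2 : (Finset.univ.filter fun x => (r x).1 = b).card ≤
            (Finset.univ : Finset (Fin t)).card := by
          refine Finset.card_le_card_of_injOn (fun x => (r x).2) (fun _ _ => Finset.mem_univ _) ?_
          intro x hx y hy hxy
          simp only [Finset.coe_filter, Finset.mem_univ, true_and, Set.mem_ofPred_eq] at hx hy
          exact hr (Prod.ext (hx.trans hy.symm) hxy)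
        simpa using h2)
    simpa using h
  have hmle : m ≤ (Finset.univ.image fun x => (r x).1).card := by
    by_contra! h
    have := Nat.mul_le_mul_left t (Nat.succ_le_of_lt h)
    rw [Nat.mul_succ] at this
    omega
  obtain ⟨U, -, hUinj, hUimg⟩ := Finset.exists_subset_injOn_image_eq_of_surjOn
    (f := fun x => (r x).1) (Finset.univ : Finset (Fin k)) (Finset.univ.image fun x => (r x).1)
    (by simp [Set.SurjOn])
  have hUcard : m ≤ U.card := by
    rw [← hUimg, Finset.card_image_of_injOn hUinj] at hmle
    exact hmle
  obtain ⟨T, hTU, hT⟩ := Finset.exists_subset_card_eq hUcard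
  obtain ⟨e, he, heT, htri⟩ := exists_triangular_order hσ huniq m T hT
  exact ⟨fun a => (r (e a)).1, fun a => (r (e a)).2, fun b => c (σ (e b)),
    fun a b hab => he (hUinj (hTU (heT a)) (hTU (heT b)) hab),
    fun a b hab => he (σ.injective (hc hab)), htri⟩

/-- For every fixed `t ≥ 2`, for all sufficiently large `n` there exists a
`t`-DRGP stencil `H` with `vrk H ≤ 6 t² ln n + 1`. -/
theorem stmt3 (t : ℕ) (ht : 2 ≤ t) :
    ∃ n₀ : ℕ, ∀ n : ℕ, n₀ ≤ n →
      ∃ H : Matrix (Fin n × Fin t) (Fin n) Bool,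
        (∀ (i : Fin n) (j : Fin t), H (i, j) i = true) ∧
        (∀ (i k : Fin n), k ≠ i →
          ∀ j j' : Fin t, H (i, j) k = true → H (i, j') k = true → j = j') ∧
        (vrk H : ℝ) ≤ 6 * (t : ℝ) ^ 2 * Real.log n + 1 := by
  refine ⟨3 * t, fun n hn => ?_⟩
  obtain ⟨f, hf⟩ := exists_forall_hits (by omega) (pow_mul_pow_lt_one ht hn rfl)
  have hlog : 0 ≤ Real.log n := Real.log_natCast_nonneg n
  refine ⟨Matrix.of fun x k => decide (k = x.1 ∨ f (x.1, k) = x.2), by simp, ?_, ?_⟩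
  · intro i k hki j j' h h'
    simp only [Matrix.of_apply, decide_eq_true_eq, hki, false_or] at h h'
    exact h.symm.trans h'
  · rw [← Nat.le_floor_iff (by positivity)]
    refine csSup_le' ?_
    rintro k ⟨r, c, hr, hc, hM⟩
    refine Nat.le_floor ?_
    by_contra! hk
    obtain ⟨i, j, d, hi, hd, h⟩ := exists_triangular_of_visFullRank _ hr hc hM
      (m := ⌊6 * (t : ℝ) * Real.log n⌋₊ + 1) (by
        have hfl := Nat.floor_le (show 0 ≤ 6 * (t : ℝ) * Real.log n by positivity)
        have h : (t : ℝ) * (⌊6 * (t : ℝ) * Real.log n⌋₊ + 1) < k + t := by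
          nlinarith [mul_le_mul_of_nonneg_left hfl (Nat.cast_nonneg (α := ℝ) t)]
        exact_mod_cast h)
    obtain ⟨a, b, hab, heq⟩ := hf i j d hi hd
    simpa [heq] using h a b hab
end
end

section
/- For every fixed natural number t ≥ 2 there is a natural number n₀ such that for every n ≥ n₀ there exists a tn × n stencil H with the following two properties: (1) the visible rank of the t-th tensor power satisfies vrk(H^{⊗t}) ≥ n, and (2) for every k with 1 ≤ k ≤ t−1, the visible rank of the k-th tensor power satisfies vrk(H^{⊗k}) ≤ 2^{5k−1}·(k!)⁴·t^{2k}·(log n)^k. -/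
noncomputable section

open Finset

/-- The stencil attached to a colouring of the cells of an `n × n` grid by `Fin t`: in the block of
colour `a`, the off-diagonal cells of colour `a` are `0`, and all the other cells are `⋆`. -/
def colorStencil {n t : ℕ} (s : Fin n × Fin n → Fin t) : Matrix (Fin n × Fin t) (Fin n) Bool :=
  Matrix.of fun p y => decide (p.1 = y ∨ s (p.1, y) ≠ p.2)

/-- The rows `r i` and columns `c i` of the `k`-th tensor power of `H`, for `i ∈ S`, form a
triangular sub-stencil with `⋆`'s on the diagonal. -/
def IsTri {ι α β : Type*} [LinearOrder ι] {k : ℕ} (H : Matrix α β Bool) (S : Finset ι)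
    (r : ι → Fin k → α) (c : ι → Fin k → β) : Prop :=
  (∀ i ∈ S, ∀ l, H (r i l) (c i l) = true) ∧
    ∀ i ∈ S, ∀ j ∈ S, i < j → ∃ l, H (r i l) (c j l) = false

/-- No value occurs in both `f i` and `f j` for distinct `i, j ∈ S`. -/
def IsSpread {ι κ γ : Type*} (S : Finset ι) (f : ι → κ → γ) : Prop :=
  ∀ i ∈ S, ∀ j ∈ S, i ≠ j → ∀ l l', f i l ≠ f j l'

lemma exists_mem_periodicPts {α : Type*} [Finite α] (f : α → α) (x : α) :
    ∃ m, f^[m] x ∈ Function.periodicPts f := by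
  obtain ⟨a, b, hab, h⟩ := Finite.exists_ne_map_eq_of_infinite (fun m => f^[m] x)
  wlog hlt : a < b generalizing a b
  · exact this b a hab.symm h.symm (by omega)
  refine ⟨a, b - a, by omega, ?_⟩
  have : f^[b - a] (f^[a] x) = f^[a] x := by
    rw [← Function.iterate_add_apply, Nat.sub_add_cancel hlt.le]; exact h.symm
  exact this

lemma exists_isolated_row {α : Type*} [Finite α] {M : Matrix α α Bool} {σ : Equiv.Perm α}
    (hσ : ∀ i, M i (σ i) = true)
    (huniq : ∀ τ : Equiv.Perm α, (∀ i, M i (τ i) = true) → τ = σ)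
    (S : Finset α) (hS : S.Nonempty) :
    ∃ i ∈ S, ∀ j ∈ S, i ≠ j → M i (σ j) = false := by
  classical
  by_contra! hcon
  have hf : ∀ i, ∃ j, M i (σ j) = true ∧ (i ∈ S → j ∈ S ∧ i ≠ j) := by
    intro i
    by_cases hi : i ∈ S
    · obtain ⟨j, hj, hij, h⟩ := hcon i hi
      exact ⟨j, by simpa using h, fun _ => ⟨hj, hij⟩⟩
    · exact ⟨i, hσ i, fun h => absurd h hi⟩
  choose f hfM hfS using hf
  have hbij := Function.bijOn_periodicPts f
  set P := Function.periodicPts f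
  set g : α → α := fun i => if i ∈ P then f i else i with hg
  have hginj : Function.Injective g := by
    intro a b hab
    simp only [hg] at hab
    split_ifs at hab with ha hb hb
    · exact hbij.injOn ha hb hab
    · exact absurd (hab ▸ hbij.mapsTo ha) hb
    · exact absurd (hab ▸ hbij.mapsTo hb) ha
    · exact hab
  let τ : Equiv.Perm α := Equiv.ofBijective g (Finite.injective_iff_bijective.mp hginj)
  have hτ := huniq (τ.trans σ) (fun i => by
    change M i (σ (g i)) = true
    simp only [hg]
    split_ifs
    · exact hfM i
    · exact hσ i)
  obtain ⟨x, hx⟩ := hS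
  obtain ⟨m, hm⟩ := exists_mem_periodicPts f x
  have hmS : f^[m] x ∈ S := by
    clear hm
    induction m with
    | zero => exact hx
    | succ m ih => rw [Function.iterate_succ_apply']; exact (hfS _ ih).1
  have h1 : σ (g (f^[m] x)) = σ (f^[m] x) := congrArg (fun ρ : Equiv.Perm α => ρ (f^[m] x)) hτ
  have h2 : g (f^[m] x) = f (f^[m] x) := if_pos hm
  exact (hfS _ hmS).2 (h2 ▸ σ.injective h1).symm

lemma exists_list_pairwise {α : Type*} [DecidableEq α] (R : α → α → Prop) (S : Finset α)
    (h : ∀ T ⊆ S, T.Nonempty → ∃ i ∈ T, ∀ j ∈ T, i ≠ j → R i j) :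
    ∃ l : List α, l.length = S.card ∧ (∀ i ∈ l, i ∈ S) ∧ l.Pairwise R := by
  induction hn : S.card generalizing S with
  | zero => exact ⟨[], by simp⟩
  | succ m ih =>
    obtain ⟨i, hi, hij⟩ := h S subset_rfl (Finset.card_pos.mp (by omega))
    obtain ⟨l, hl, hlS, hR⟩ := ih (S.erase i) (fun T hT => h T (hT.trans (erase_subset _ _)))
      (by rw [card_erase_of_mem hi, hn]; rfl)
    refine ⟨i :: l, by simp [hl], ?_, List.pairwise_cons.mpr ⟨fun j hj => ?_, hR⟩⟩
    · intro j hj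
      rcases List.mem_cons.mp hj with rfl | hj
      · exact hi
      · exact mem_of_mem_erase (hlS j hj)
    · have := mem_erase.mp (hlS j hj)
      exact hij j this.2 this.1.symm

lemma VisFullRank.exists_isTri {α β : Type*} {k L : ℕ} {H : Matrix α β Bool}
    {r : Fin L → Fin k → α} {c : Fin L → Fin k → β}
    (h : VisFullRank (Matrix.of fun i j => stPow H k (r i) (c j))) :
    ∃ (r' : Fin L → Fin k → α) (c' : Fin L → Fin k → β), IsTri H univ r' c' := by
  obtain ⟨σ, hσ, huniq⟩ := h
  obtain ⟨l, hl, -, hR⟩ := exists_list_pairwise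
    (fun i j => stPow H k (r i) (c (σ j)) = false) univ
    (fun T _ hT => exists_isolated_row hσ huniq T hT)
  rw [card_univ, Fintype.card_fin] at hl
  let e : Fin L → Fin L := fun i => l.get (i.cast hl.symm)
  refine ⟨fun i => r (e i), fun i => c (σ (e i)), fun i _ => ?_, fun i _ j _ hij => ?_⟩
  · have := hσ (e i)
    simpa [stPow] using this
  · have := List.pairwise_iff_get.mp hR (i.cast hl.symm) (j.cast hl.symm) hij
    simpa [stPow, e] using this

lemma vrk_stPow_le {α β : Type*} {k B : ℕ} {H : Matrix α β Bool}
    (h : ∀ (L : ℕ) (r : Fin L → Fin k → α) (c : Fin L → Fin k → β), IsTri H univ r c → L ≤ B) :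
    vrk (stPow H k) ≤ B := by
  refine csSup_le' ?_
  rintro L ⟨r, c, -, -, hM⟩
  obtain ⟨r', c', h'⟩ := hM.exists_isTri
  exact h L r' c' h'

lemma le_vrk_colorStencil {n t : ℕ} (s : Fin n × Fin n → Fin t) (ht : 0 < t) :
    n ≤ vrk (stPow (colorStencil s) t) := by
  refine le_csSup ⟨Fintype.card (Fin t → Fin n × Fin t), ?_⟩
    ⟨fun i l => (i, l), fun i _ => i, fun i j h => ?_, fun i j h => ?_, ?_⟩
  · rintro L ⟨r, c, hr, -, -⟩
    simpa using Fintype.card_le_of_injective r hr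
  · exact (Prod.ext_iff.mp (congrFun h ⟨0, ht⟩)).1
  · exact congrFun h ⟨0, ht⟩
  · refine ⟨1, by simp [stPow, colorStencil], fun τ hτ => ?_⟩
    ext i
    have := hτ i
    simp only [stPow, colorStencil, Matrix.of_apply, decide_eq_true_eq] at this
    rcases this (s (i, τ i)) with h | h
    · simp [← h]
    · exact absurd rfl h

section Triangular

variable {ι α β : Type*} [LinearOrder ι] {k : ℕ} {H : Matrix α β Bool} {S T : Finset ι}

lemma IsTri.subset {r : ι → Fin k → α} {c : ι → Fin k → β} (h : IsTri H S r c) (hTS : T ⊆ S) :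
    IsTri H T r c :=
  ⟨fun i hi => h.1 i (hTS hi), fun i hi j hj => h.2 i (hTS hi) j (hTS hj)⟩

lemma IsTri.removeCoord {r : ι → Fin (k + 1) → α} {c : ι → Fin (k + 1) → β}
    (h : IsTri H S r c) (l : Fin (k + 1))
    (hl : ∀ i ∈ S, ∀ j ∈ S, H (r i l) (c j l) = true) :
    IsTri H S (fun i m => r i (l.succAbove m)) (fun i m => c i (l.succAbove m)) := by
  refine ⟨fun i hi m => h.1 i hi _, fun i hi j hj hij => ?_⟩
  obtain ⟨m, hm⟩ := h.2 i hi j hj hij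
  rcases Fin.eq_self_or_eq_succAbove l m with rfl | ⟨m, rfl⟩
  · simp [hl i hi j hj] at hm
  · exact ⟨m, hm⟩

lemma IsTri.card_filter_row_le [DecidableEq α] {B : ℕ}
    (hB : ∀ (S : Finset ι) (r : ι → Fin k → α) (c : ι → Fin k → β), IsTri H S r c → S.card ≤ B)
    {r : ι → Fin (k + 1) → α} {c : ι → Fin (k + 1) → β} (h : IsTri H S r c)
    (l : Fin (k + 1)) (a : α) : (S.filter fun i => r i l = a).card ≤ B := by
  refine hB _ _ _ ((h.subset (filter_subset _ S)).removeCoord l fun i hi j hj => ?_)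
  rw [mem_filter] at hi hj
  rw [hi.2, ← hj.2]
  exact h.1 j hj.1 l

lemma IsTri.card_filter_col_le [DecidableEq β] {B : ℕ}
    (hB : ∀ (S : Finset ι) (r : ι → Fin k → α) (c : ι → Fin k → β), IsTri H S r c → S.card ≤ B)
    {r : ι → Fin (k + 1) → α} {c : ι → Fin (k + 1) → β} (h : IsTri H S r c)
    (l : Fin (k + 1)) (b : β) : (S.filter fun i => c i l = b).card ≤ B := by
  refine hB _ _ _ ((h.subset (filter_subset _ S)).removeCoord l fun i hi j hj => ?_)
  rw [mem_filter] at hi hj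
  rw [hj.2, ← hi.2]
  exact h.1 i hi.1 l

end Triangular

lemma exists_independent_subset {ι : Type*} [DecidableEq ι] (R : ι → ι → Prop) [DecidableRel R]
    (hsymm : ∀ i j, R i j → R j i) (hrefl : ∀ i, R i i) (S : Finset ι) (D : ℕ)
    (hD : ∀ j ∈ S, (S.filter fun i => R i j).card ≤ D) :
    ∃ T ⊆ S, (∀ i ∈ T, ∀ j ∈ T, i ≠ j → ¬ R i j) ∧ S.card ≤ T.card * D := by
  obtain ⟨T, hT, hmax⟩ := exists_max_image
    (S.powerset.filter fun T => ∀ i ∈ T, ∀ j ∈ T, i ≠ j → ¬ R i j) card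
    ⟨∅, by simp⟩
  rw [mem_filter, mem_powerset] at hT
  refine ⟨T, hT.1, hT.2, ?_⟩
  have hcover : S ⊆ T.biUnion fun j => S.filter fun i => R i j := by
    intro i hi
    rw [mem_biUnion]
    by_contra! hcon
    have hno : ∀ j ∈ T, ¬ R i j := fun j hj hR => hcon j hj (mem_filter.mpr ⟨hi, hR⟩)
    have hiT : i ∉ T := fun h => hno i h (hrefl i)
    have := hmax (insert i T) (by
      rw [mem_filter, mem_powerset]
      refine ⟨insert_subset hi hT.1, fun a ha b hb hab => ?_⟩
      rcases mem_insert.mp ha with rfl | haT <;> rcases mem_insert.mp hb with rfl | hbT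
      · exact absurd rfl hab
      · exact hno b hbT
      · exact fun h => hno a haT (hsymm _ _ h)
      · exact hT.2 a haT b hbT hab)
    rw [card_insert_of_notMem hiT] at this
    omega
  calc S.card ≤ _ := card_le_card hcover
    _ ≤ ∑ j ∈ T, (S.filter fun i => R i j).card := card_biUnion_le
    _ ≤ ∑ _j ∈ T, D := sum_le_sum fun j hj => hD j (hT.1 hj)
    _ = T.card * D := by simp

lemma IsTri.card_le_of_forall_not_isSpread {ι : Type*} [LinearOrder ι] {n t k B M : ℕ}
    {H : Matrix (Fin n × Fin t) (Fin n) Bool}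
    (hB : ∀ (S : Finset ι) (r : ι → Fin k → Fin n × Fin t) (c : ι → Fin k → Fin n),
      IsTri H S r c → S.card ≤ B)
    (hM : ∀ (r : Fin M → Fin (k + 1) → Fin n × Fin t) (c : Fin M → Fin (k + 1) → Fin n),
      IsTri H univ r c → IsSpread univ (fun i l => (r i l).1) → ¬ IsSpread univ c)
    {S : Finset ι} {r : ι → Fin (k + 1) → Fin n × Fin t} {c : ι → Fin (k + 1) → Fin n}
    (h : IsTri H S r c) : S.card ≤ M * ((k + 1) ^ 2 * ((t + 1) * B)) := by
  obtain ⟨T, hTS, hT, hcard⟩ := exists_independent_subset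
    (fun i j => ∃ l l', (r i l).1 = (r j l').1 ∨ c i l = c j l')
    (fun i j ⟨l, l', h⟩ => ⟨l', l, h.imp Eq.symm Eq.symm⟩)
    (fun i => ⟨0, 0, Or.inl rfl⟩) S ((k + 1) ^ 2 * ((t + 1) * B)) (by
      intro j _
      have hsub : (S.filter fun i => ∃ l l', (r i l).1 = (r j l').1 ∨ c i l = c j l') ⊆
          (univ : Finset (Fin (k + 1) × Fin (k + 1))).biUnion fun p =>
            ((univ : Finset (Fin t)).biUnion fun a =>
              S.filter fun i => r i p.1 = ((r j p.2).1, a)) ∪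
            S.filter fun i => c i p.1 = c j p.2 := by
        intro i hi
        obtain ⟨hiS, l, l', hl⟩ := mem_filter.mp hi
        refine mem_biUnion.mpr ⟨(l, l'), mem_univ _, mem_union.mpr ?_⟩
        rcases hl with hl | hl
        · exact Or.inl (mem_biUnion.mpr ⟨(r i l).2, mem_univ _,
            mem_filter.mpr ⟨hiS, Prod.ext hl rfl⟩⟩)
        · exact Or.inr (mem_filter.mpr ⟨hiS, hl⟩)
      refine (card_le_card hsub).trans ((card_biUnion_le_card_mul _ _ ((t + 1) * B) ?_).trans ?_)
      · intro p _
        have h1 := card_biUnion_le_card_mul (univ : Finset (Fin t))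
          (fun a => S.filter fun i => r i p.1 = ((r j p.2).1, a)) B
          (fun a _ => h.card_filter_row_le hB _ _)
        have h2 := h.card_filter_col_le hB p.1 (c j p.2)
        rw [card_univ, Fintype.card_fin] at h1
        exact (card_union_le _ _).trans (by linarith)
      · simp [sq])
  refine hcard.trans (Nat.mul_le_mul_right _ ?_)
  by_contra! hlt
  obtain ⟨T', hT'T, hT'⟩ := exists_subset_card_eq hlt.le
  let e := T'.orderEmbOfFin hT'
  have he : ∀ i, e i ∈ T := fun i => hT'T (T'.orderEmbOfFin_mem hT' i)
  refine hM (fun i => r (e i)) (fun i => c (e i))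
    ⟨fun i _ => h.1 _ (hTS (he i)), fun i _ j _ hij =>
      h.2 _ (hTS (he i)) _ (hTS (he j)) (e.lt_iff_lt.mpr hij)⟩ ?_ ?_
  · intro i _ j _ hij l l' heq
    exact hT _ (he i) _ (he j) (e.injective.ne hij) ⟨l, l', Or.inl heq⟩
  · intro i _ j _ hij l l' heq
    exact hT _ (he i) _ (he j) (e.injective.ne hij) ⟨l, l', Or.inr heq⟩

/-- The bound on the visible rank of `H^{⊗k}` obtained by iterating
`IsTri.card_le_of_forall_not_isSpread` with `M = k * m`. -/
lemma IsTri.card_le {ι : Type*} [LinearOrder ι] {n t m K : ℕ}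
    {H : Matrix (Fin n × Fin t) (Fin n) Bool}
    (hM : ∀ k, 1 ≤ k → k ≤ K →
      ∀ (r : Fin (k * m) → Fin k → Fin n × Fin t) (c : Fin (k * m) → Fin k → Fin n),
      IsTri H univ r c → IsSpread univ (fun i l => (r i l).1) → ¬ IsSpread univ c)
    (k : ℕ) (hk : k ≤ K) (S : Finset ι) (r : ι → Fin k → Fin n × Fin t) (c : ι → Fin k → Fin n)
    (h : IsTri H S r c) : S.card ≤ k.factorial ^ 3 * ((t + 1) * m) ^ k := by
  induction k generalizing S with
  | zero =>
    have : S.card ≤ 1 := by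
      by_contra! hlt
      obtain ⟨i, hi, j, hj, hij⟩ := one_lt_card.mp hlt
      rcases lt_or_gt_of_ne hij with hlt | hlt
      · exact (h.2 i hi j hj hlt).choose.elim0
      · exact (h.2 j hj i hi hlt).choose.elim0
    simpa using this
  | succ k ih =>
    refine (h.card_le_of_forall_not_isSpread (fun S r c => ih (by omega) S r c)
      (hM (k + 1) (by omega) hk)).trans (le_of_eq ?_)
    rw [Nat.factorial_succ]
    ring

lemma card_filter_forall_apply_eq_mul_le {P C κ : Type*} [Fintype P] [Fintype C] [Fintype κ]
    [DecidableEq P] [DecidableEq C] [DecidableEq κ] {cell : P → C}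
    (hcell : Function.Injective cell) (a : P → κ) :
    (univ.filter fun s : C → κ => ∀ p, s (cell p) = a p).card *
      Fintype.card κ ^ Fintype.card P ≤ Fintype.card κ ^ Fintype.card C := by
  rw [← Fintype.card_fun (α := P), ← Fintype.card_fun (α := C), ← card_univ (α := P → κ),
    ← card_product, ← card_univ (α := C → κ)]
  refine card_le_card_of_injOn (fun q => Function.extend cell q.2 q.1) (fun _ _ => mem_univ _) ?_
  rintro ⟨s, g⟩ hs ⟨s', g'⟩ hs' heq
  simp only [coe_product, Set.mem_prod, mem_coe, mem_filter] at hs hs'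
  have h1 := congrFun heq
  refine Prod.ext (funext fun z => ?_) (funext fun p => ?_)
  · by_cases hz : ∃ p, cell p = z
    · obtain ⟨p, rfl⟩ := hz
      exact (hs.1.2 p).trans (hs'.1.2 p).symm
    · have := h1 z
      simp only [Function.extend_apply' _ _ _ hz] at this
      exact this
  · have := h1 (cell p)
    simp only [hcell.extend_apply] at this
    exact this

open Classical in
lemma card_filter_exists_isTri_isSpread_mul_le (n t k M : ℕ) :
    (univ.filter fun s : Fin n × Fin n → Fin t =>
      ∃ (r : Fin M → Fin k → Fin n × Fin t) (c : Fin M → Fin k → Fin n),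
        IsTri (colorStencil s) univ r c ∧ IsSpread univ (fun i l => (r i l).1) ∧
          IsSpread univ c).card * t ^ (∑ i ∈ range M, i) ≤
      (n * t * n) ^ (k * M) * k ^ (∑ i ∈ range M, i) * t ^ (n * n) := by
  let P := (j : Fin M) × Fin j
  have hP : Fintype.card P = ∑ i ∈ range M, i := by
    simp [P, Fin.sum_univ_eq_sum_range (fun i => i) M]
  let fst : P → Fin M := fun p => ⟨p.2, p.2.2.trans p.1.2⟩
  have hfst : ∀ p, fst p < p.1 := fun p => p.2.2
  let X := (Fin M → Fin k → Fin n × Fin t) × (Fin M → Fin k → Fin n) × (P → Fin k)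
  let cell : X → P → Fin n × Fin n :=
    fun x p => ((x.1 (fst p) (x.2.2 p)).1, x.2.1 p.1 (x.2.2 p))
  let F : X → Finset (Fin n × Fin n → Fin t) := fun x =>
    if Function.Injective (cell x) then
      univ.filter fun s => ∀ p, s (cell x p) = (x.1 (fst p) (x.2.2 p)).2
    else ∅
  have hX : Fintype.card X = (n * t * n) ^ (k * M) * k ^ (∑ i ∈ range M, i) := by
    simp only [X, Fintype.card_prod, Fintype.card_fun, Fintype.card_fin, hP]
    ring
  have hF : ∀ x, (F x).card * t ^ (∑ i ∈ range M, i) ≤ t ^ (n * n) := by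
    intro x
    simp only [F]
    split_ifs with hx
    · simpa [hP] using card_filter_forall_apply_eq_mul_le hx
        fun p => (x.1 (fst p) (x.2.2 p)).2
    · simp
  rw [← hX]
  calc _ ≤ (∑ x : X, (F x).card) * t ^ (∑ i ∈ range M, i) := by
        refine Nat.mul_le_mul_right _ ((card_le_card ?_).trans card_biUnion_le)
        intro s hs
        obtain ⟨-, r, c, htri, hr, hc⟩ := mem_filter.mp hs
        have hz : ∀ p : P, ∃ l, colorStencil s (r (fst p) l) (c p.1 l) = false := fun p =>
          htri.2 _ (mem_univ _) _ (mem_univ _) (hfst p)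
        choose φ hφ using hz
        refine mem_biUnion.mpr ⟨(r, c, φ), mem_univ _, ?_⟩
        have hinj : Function.Injective (cell (r, c, φ)) := by
          rintro ⟨j, i⟩ ⟨j', i'⟩ heq
          have h1 : fst ⟨j, i⟩ = fst ⟨j', i'⟩ := by
            by_contra hne
            exact hr _ (mem_univ _) _ (mem_univ _) hne (φ ⟨j, i⟩) (φ ⟨j', i'⟩)
              (Prod.mk.inj heq).1
          have h2 : j = j' := by
            by_contra hne
            exact hc _ (mem_univ _) _ (mem_univ _) hne _ _ (congrArg Prod.snd heq)
          subst h2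
          have h3 : i = i' := Fin.ext (Fin.mk.inj_iff.mp h1)
          rw [h3]
        simp only [F, if_pos hinj, mem_filter, mem_univ, true_and]
        intro p
        have := hφ p
        simp only [colorStencil, Matrix.of_apply, decide_eq_false_iff_not, not_or,
          not_not] at this
        exact this.2
    _ = ∑ x : X, (F x).card * t ^ (∑ i ∈ range M, i) := sum_mul _ _ _
    _ ≤ ∑ _x : X, t ^ (n * n) := sum_le_sum fun x _ => hF x
    _ = Fintype.card X * t ^ (n * n) := by simp

lemma exists_colorStencil_no_isSpread {n t m : ℕ} (ht : 2 ≤ t)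
    (hm : ∀ k, 1 ≤ k → k ≤ t - 1 → (n * t * n) ^ (k * (k * m)) *
      k ^ (∑ i ∈ range (k * m), i) * t ≤ t ^ (∑ i ∈ range (k * m), i)) :
    ∃ s : Fin n × Fin n → Fin t, ∀ k, 1 ≤ k → k ≤ t - 1 →
      ∀ (r : Fin (k * m) → Fin k → Fin n × Fin t) (c : Fin (k * m) → Fin k → Fin n),
      IsTri (colorStencil s) univ r c → IsSpread univ (fun i l => (r i l).1) →
        ¬ IsSpread univ c := by
  classical
  by_contra! hcon
  let bad : ℕ → Finset (Fin n × Fin n → Fin t) := fun k => univ.filter fun s =>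
      ∃ (r : Fin (k * m) → Fin k → Fin n × Fin t) (c : Fin (k * m) → Fin k → Fin n),
        IsTri (colorStencil s) univ r c ∧ IsSpread univ (fun i l => (r i l).1) ∧
          IsSpread univ c
  have hbad : ∀ k ∈ Icc 1 (t - 1), (bad k).card * t ≤ t ^ (n * n) := by
    intro k hk
    rw [mem_Icc] at hk
    have h1 := card_filter_exists_isTri_isSpread_mul_le n t k (k * m)
    have h2 := hm k hk.1 hk.2
    have hpos : 0 < t ^ (∑ i ∈ range (k * m), i) := by positivity
    refine Nat.le_of_mul_le_mul_right (c := t ^ (∑ i ∈ range (k * m), i)) ?_ hpos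
    calc (bad k).card * t * t ^ (∑ i ∈ range (k * m), i)
        = ((bad k).card * t ^ (∑ i ∈ range (k * m), i)) * t := by ring
      _ ≤ ((n * t * n) ^ (k * (k * m)) * k ^ (∑ i ∈ range (k * m), i) * t ^ (n * n)) * t := by
          gcongr
      _ = ((n * t * n) ^ (k * (k * m)) * k ^ (∑ i ∈ range (k * m), i) * t) * t ^ (n * n) := by
          ring
      _ ≤ _ := by rw [mul_comm (t ^ (n * n))]; gcongr
  have hcov : (univ : Finset (Fin n × Fin n → Fin t)) ⊆ (Icc 1 (t - 1)).biUnion bad := by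
    intro s _
    obtain ⟨k, h1, h2, r, c, h⟩ := hcon s
    exact mem_biUnion.mpr ⟨k, mem_Icc.mpr ⟨h1, h2⟩, mem_filter.mpr ⟨mem_univ _, r, c, h⟩⟩
  have hle := (card_le_card hcov).trans card_biUnion_le
  have hsum : (∑ k ∈ Icc 1 (t - 1), (bad k).card) * t ≤ (t - 1) * t ^ (n * n) := by
    rw [sum_mul]
    exact (sum_le_sum hbad).trans (by simp)
  have hcard : (univ : Finset (Fin n × Fin n → Fin t)).card = t ^ (n * n) := by simp
  rw [hcard] at hle
  have hpos : 0 < t ^ (n * n) := by positivity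
  have h3 := (Nat.mul_le_mul_right t hle).trans hsum
  rw [mul_comm] at h3
  have := Nat.le_of_mul_le_mul_right h3 hpos
  omega

lemma pow_mul_pow_mul_le_pow {n t k M P : ℕ} (ht : 0 < t) (hk : k ≤ t - 1) (hn : t ^ 2 ≤ n)
    (hP : P * 2 = M * (M - 1)) (hkM : 1 ≤ k * M)
    (hM : 6 * t * k * Real.log n ≤ M - 1) :
    (n * t * n) ^ (k * M) * k ^ P * t ≤ t ^ P := by
  have htR : (0 : ℝ) < t := by exact_mod_cast ht
  have hnR : (0 : ℝ) < n := by exact_mod_cast (pow_pos ht 2).trans_le hn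
  have hlogt : 0 ≤ Real.log t := Real.log_natCast_nonneg t
  have hlog : 2 * Real.log t ≤ Real.log n := by
    have := Real.log_le_log (by positivity) (show (t : ℝ) ^ 2 ≤ n by exact_mod_cast hn)
    simpa using this
  have hM1 : 1 ≤ M := Nat.pos_of_ne_zero fun h => by simp [h] at hkM
  have hPR : (P : ℝ) * 2 = M * (M - 1) := by
    have : ((P * 2 : ℕ) : ℝ) = ((M * (M - 1) : ℕ) : ℝ) := by rw [hP]
    push_cast [Nat.cast_sub hM1] at this
    exact this
  have hkt : (k : ℝ) ≤ t * Real.exp (-(1 / t)) := by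
    have h1 : (k : ℝ) ≤ t - 1 := by
      have : k + 1 ≤ t := by omega
      have : (k : ℝ) + 1 ≤ t := by exact_mod_cast this
      linarith
    have h2 := Real.add_one_le_exp (-(1 / (t : ℝ)))
    calc (k : ℝ) ≤ t * (-(1 / t) + 1) := by field_simp; linarith
      _ ≤ _ := by gcongr
  have hbase : (n : ℝ) * t * n = Real.exp (2 * Real.log n + Real.log t) := by
    rw [Real.exp_add, two_mul, Real.exp_add, Real.exp_log hnR, Real.exp_log htR]
    ring
  have hkMR : (1 : ℝ) ≤ k * M := by exact_mod_cast hkM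
  have hexp : (k * M : ℝ) * (2 * Real.log n + Real.log t) + Real.log t ≤ P * (1 / t) := by
    calc (k * M : ℝ) * (2 * Real.log n + Real.log t) + Real.log t
        ≤ (k * M : ℝ) * (2 * Real.log n + Real.log t) + k * M * Real.log t := by
          gcongr
          exact le_mul_of_one_le_left hlogt hkMR
      _ = (k * M : ℝ) * (2 * Real.log n + 2 * Real.log t) := by ring
      _ ≤ (k * M : ℝ) * (3 * Real.log n) := by gcongr; linarith
      _ = M * (6 * t * k * Real.log n) / (2 * t) := by field_simp; ring
      _ ≤ M * (M - 1) / (2 * t) := by gcongr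
      _ = P * (1 / t) := by rw [← hPR]; field_simp
  have key : ((n : ℝ) * t * n) ^ (k * M) * (k : ℝ) ^ P * t ≤ (t : ℝ) ^ P := by
    calc ((n : ℝ) * t * n) ^ (k * M) * (k : ℝ) ^ P * t
        ≤ ((n : ℝ) * t * n) ^ (k * M) * (t * Real.exp (-(1 / t))) ^ P * t := by gcongr
      _ = Real.exp ((k * M : ℝ) * (2 * Real.log n + Real.log t) + Real.log t - P * (1 / t)) *
            (t : ℝ) ^ P := by
          rw [hbase, mul_pow, ← Real.exp_nat_mul, ← Real.exp_nat_mul, sub_eq_add_neg,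
            Real.exp_add, Real.exp_add, Real.exp_log htR]
          push_cast
          rw [mul_neg]
          ring
      _ ≤ 1 * (t : ℝ) ^ P := by
          gcongr
          exact Real.exp_le_one_iff.mpr (by linarith)
      _ = _ := one_mul _
  exact_mod_cast key

lemma factorial_pow_three_mul_le {k m t : ℕ} {x : ℝ} (hk : 1 ≤ k) (ht : 1 ≤ t) (hx : 0 ≤ x)
    (hm : (m : ℝ) ≤ 8 * t * x) :
    ((k.factorial ^ 3 * ((t + 1) * m) ^ k : ℕ) : ℝ) ≤
      2 ^ (5 * k - 1) * (k.factorial : ℝ) ^ 4 * (t : ℝ) ^ (2 * k) * x ^ k := by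
  have htR : (1 : ℝ) ≤ t := by exact_mod_cast ht
  have hf : (1 : ℝ) ≤ k.factorial := by exact_mod_cast k.factorial_pos
  have h1 : ((t : ℝ) + 1) * m ≤ 2 ^ 4 * t ^ 2 * x := by
    calc ((t : ℝ) + 1) * m ≤ (2 * t) * (8 * t * x) := by gcongr; linarith
      _ = _ := by ring
  push_cast
  calc (k.factorial : ℝ) ^ 3 * (((t : ℝ) + 1) * m) ^ k
      ≤ (k.factorial : ℝ) ^ 4 * (2 ^ 4 * t ^ 2 * x) ^ k := by
        gcongr
        · norm_num
    _ = 2 ^ (4 * k) * (k.factorial : ℝ) ^ 4 * (t : ℝ) ^ (2 * k) * x ^ k := by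
        rw [mul_pow, mul_pow, ← pow_mul, ← pow_mul]; ring
    _ ≤ _ := by
        gcongr
        · exact one_le_two
        · omega

/-- For every fixed `t ≥ 2`, for all sufficiently large `n` there exists a
`tn × n` stencil `H` with `vrk (H^{⊗t}) ≥ n` while for all `1 ≤ k ≤ t-1`,
`vrk (H^{⊗k}) ≤ 2^{5k-1} (k!)⁴ t^{2k} (log n)^k`. -/
theorem stmt4 (t : ℕ) (ht : 2 ≤ t) :
    ∃ n₀ : ℕ, ∀ n : ℕ, n₀ ≤ n →
      ∃ H : Matrix (Fin n × Fin t) (Fin n) Bool,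
        n ≤ vrk (stPow H t) ∧
        ∀ k : ℕ, 1 ≤ k → k ≤ t - 1 →
          (vrk (stPow H k) : ℝ) ≤
            2 ^ (5 * k - 1) * (Nat.factorial k : ℝ) ^ 4 * (t : ℝ) ^ (2 * k) *
              Real.log n ^ k := by
  refine ⟨t ^ 2 + 3, fun n hn => ?_⟩
  have htR : (2 : ℝ) ≤ t := by exact_mod_cast ht
  have hlog : 1 ≤ Real.log n := by
    rw [Real.le_log_iff_exp_le (by exact_mod_cast (by omega : 0 < n))]
    have : (3 : ℝ) ≤ n := by exact_mod_cast (by omega : 3 ≤ n)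
    linarith [Real.exp_one_lt_d9]
  set m := ⌊8 * t * Real.log n⌋₊ with hm
  have hm_le : (m : ℝ) ≤ 8 * t * Real.log n := Nat.floor_le (by positivity)
  have hm_lt : 8 * t * Real.log n < m + 1 := Nat.lt_floor_add_one _
  have htlog : 2 ≤ t * Real.log n := by nlinarith
  have hm_pos : 0 < m := by
    have : (0 : ℝ) < m := by linarith
    exact_mod_cast this
  obtain ⟨s, hs⟩ := exists_colorStencil_no_isSpread (n := n) (m := m) ht (by
    intro k hk1 hk2
    refine pow_mul_pow_mul_le_pow (by omega) hk2 (by omega) (sum_range_id_mul_two _)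
      (by have := Nat.mul_pos hk1 (Nat.mul_pos hk1 hm_pos); omega) ?_
    have hkR : (1 : ℝ) ≤ k := by exact_mod_cast hk1
    push_cast
    nlinarith)
  refine ⟨colorStencil s, le_vrk_colorStencil s (by omega), fun k hk1 hk2 => ?_⟩
  refine le_trans (Nat.cast_le.mpr (vrk_stPow_le (B := k.factorial ^ 3 * ((t + 1) * m) ^ k) ?_))
    (factorial_pow_three_mul_le hk1 (by omega) (by linarith) hm_le)
  intro L r c h
  simpa using h.card_le hs k hk2
end
end

section
/- Let H be an m × n stencil and let a, b be natural numbers. If H contains no a × b sub-stencil consisting entirely of zeros (i.e., there are no a rows and b columns such that every entry of H on those rows and columns is 0), then vrk(H) < a + b. -/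
noncomputable section

/-- A self-map of a nonempty finite type has a periodic point. -/
theorem nonempty_periodicPts {α : Type*} [Finite α] [Nonempty α] (f : α → α) :
    (Function.periodicPts f).Nonempty := by
  obtain ⟨x⟩ := ‹Nonempty α›
  obtain ⟨p, q, hpq, h⟩ := Finite.exists_ne_map_eq_of_infinite fun n : ℕ => f^[n] x
  wlog hlt : p < q generalizing p q
  · exact this q p hpq.symm h.symm (by omega)
  refine ⟨f^[p] x, Function.mk_mem_periodicPts (Nat.sub_pos_of_lt hlt) ?_⟩
  change f^[q - p] (f^[p] x) = f^[p] x
  rw [← Function.iterate_add_apply, Nat.sub_add_cancel hlt.le]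
  exact h.symm

open Classical in
/-- A self-map of a nonempty finite type agrees with some permutation wherever that
permutation moves a point, and on at least one point. -/
theorem exists_perm_eq_or_eq_self {α : Type*} [Finite α] [Nonempty α] (f : α → α) :
    ∃ π : Equiv.Perm α, (∀ x, π x = f x ∨ π x = x) ∧ ∃ x, π x = f x := by
  have hb := Function.bijOn_periodicPts (f := f)
  have hinj : Function.Injective fun x => if x ∈ Function.periodicPts f then f x else x := by
    intro x y hxy
    by_cases hx : x ∈ Function.periodicPts f <;> by_cases hy : y ∈ Function.periodicPts f <;>
      simp only [hx, hy, if_true, if_false] at hxy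
    · exact hb.injOn hx hy hxy
    · exact absurd (hxy ▸ hb.mapsTo hx) hy
    · exact absurd (hxy ▸ hb.mapsTo hy) hx
    · exact hxy
  refine ⟨Equiv.ofBijective _ hinj.bijective_of_finite, fun x => ?_, ?_⟩
  · by_cases hx : x ∈ Function.periodicPts f <;> simp [hx]
  · obtain ⟨x, hx⟩ := nonempty_periodicPts f
    exact ⟨x, by simp [hx]⟩

open Classical in
/-- If `σ` is the only generalized diagonal of ⋆'s of `M`, every nonempty set `T` of rows
contains a row whose only ⋆ in the columns `σ '' T` lies on the diagonal. -/
theorem exists_mem_forall_ne_eq_false {α : Type*} [Finite α] {M : Matrix α α Bool}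
    {σ : Equiv.Perm α} (hσ : ∀ i, M i (σ i) = true)
    (huniq : ∀ τ : Equiv.Perm α, (∀ i, M i (τ i) = true) → τ = σ)
    {T : Set α} (hT : T.Nonempty) :
    ∃ i ∈ T, ∀ j ∈ T, j ≠ i → M i (σ j) = false := by
  by_contra! hcon
  have hstep : ∀ i : T, ∃ j : T, j ≠ i ∧ M i (σ j) = true := by
    rintro ⟨i, hi⟩
    obtain ⟨j, hj, hne, hM⟩ := hcon i hi
    exact ⟨⟨j, hj⟩, fun he => hne (congrArg Subtype.val he), by simpa using hM⟩
  choose g hne hg using hstep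
  have : Nonempty T := hT.to_subtype
  obtain ⟨π, hπ, x, hx⟩ := exists_perm_eq_or_eq_self g
  have hτ := huniq (σ * Equiv.Perm.ofSubtype π) fun i => by
    by_cases hi : i ∈ T
    · rw [Equiv.Perm.mul_apply, Equiv.Perm.ofSubtype_apply_of_mem π hi]
      rcases hπ ⟨i, hi⟩ with h | h <;> rw [h]
      · exact hg ⟨i, hi⟩
      · exact hσ i
    · rw [Equiv.Perm.mul_apply, Equiv.Perm.ofSubtype_apply_of_not_mem π hi]
      exact hσ i
  have hfix := σ.injective (Equiv.congr_fun hτ x)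
  rw [Equiv.Perm.ofSubtype_apply_coe] at hfix
  exact hne x (hx ▸ Subtype.ext hfix)

/-- Triangular form of a visibly full rank stencil: for every `s` there is a set `A` of `s`
rows vanishing on the diagonal columns of the other rows. -/
theorem exists_card_eq_forall_notMem_eq_false {α : Type*} [Fintype α]
    {M : Matrix α α Bool} {σ : Equiv.Perm α} (hσ : ∀ i, M i (σ i) = true)
    (huniq : ∀ τ : Equiv.Perm α, (∀ i, M i (τ i) = true) → τ = σ)
    {s : ℕ} (hs : s ≤ Fintype.card α) :
    ∃ A : Finset α, A.card = s ∧ ∀ i ∈ A, ∀ j ∉ A, M i (σ j) = false := by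
  classical
  induction s with
  | zero => exact ⟨∅, by simp⟩
  | succ s ih =>
    obtain ⟨A, hA, hz⟩ := ih (by omega)
    obtain ⟨y, hy⟩ : ∃ y, y ∉ A := by
      by_contra! hall
      have := Finset.card_eq_iff_eq_univ A |>.2 (Finset.eq_univ_iff_forall.2 hall)
      omega
    obtain ⟨i, hi, hrow⟩ :=
      exists_mem_forall_ne_eq_false hσ huniq (T := {x | x ∉ A}) ⟨y, hy⟩
    refine ⟨insert i A, by rw [Finset.card_insert_of_notMem hi, hA], fun x hx j hj => ?_⟩
    rw [Finset.mem_insert, not_or] at hj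
    rcases Finset.mem_insert.1 hx with rfl | hx
    · exact hrow j hj.2 hj.1
    · exact hz x hx j hj.2

/-- A visibly full rank `k × k` stencil with `a + b ≤ k` has an `a × b` all-zero sub-stencil. -/
theorem VisFullRank.exists_zero_substencil {k a b : ℕ} {M : Matrix (Fin k) (Fin k) Bool}
    (hM : VisFullRank M) (hk : a + b ≤ k) :
    ∃ (r : Fin a → Fin k) (c : Fin b → Fin k), Function.Injective r ∧ Function.Injective c ∧
      ∀ i j, M (r i) (c j) = false := by
  obtain ⟨σ, hσ, huniq⟩ := hM
  obtain ⟨A, hA, hz⟩ := exists_card_eq_forall_notMem_eq_false hσ huniq (s := a)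
    (by rw [Fintype.card_fin]; omega)
  obtain ⟨B, hBA, hB⟩ := Finset.exists_subset_card_eq (s := Aᶜ) (n := b)
    (by rw [Finset.card_compl, hA, Fintype.card_fin]; omega)
  refine ⟨A.orderEmbOfFin hA, fun j => σ (B.orderEmbOfFin hB j), (A.orderEmbOfFin hA).injective,
    σ.injective.comp (B.orderEmbOfFin hB).injective, fun i j => ?_⟩
  exact hz _ (A.orderEmbOfFin_mem hA i) _
    (Finset.mem_compl.1 (hBA (B.orderEmbOfFin_mem hB j)))

/-- The visible rank of a stencil with finitely many rows is attained. -/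
theorem exists_visFullRank_vrk {α β : Type*} [Fintype α] (H : Matrix α β Bool) :
    ∃ r : Fin (vrk H) → α, ∃ c : Fin (vrk H) → β, Function.Injective r ∧ Function.Injective c ∧
      VisFullRank (Matrix.of fun i j => H (r i) (c j)) := by
  refine Nat.sSup_mem (s := {k : ℕ | ∃ r : Fin k → α, ∃ c : Fin k → β,
    Function.Injective r ∧ Function.Injective c ∧
    VisFullRank (Matrix.of fun i j => H (r i) (c j))}) ?_ ?_
  · exact ⟨0, Fin.elim0, Fin.elim0, fun i => i.elim0, fun i => i.elim0,
      1, fun i => i.elim0, fun τ _ => Subsingleton.elim τ 1⟩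
  · refine ⟨Fintype.card α, ?_⟩
    rintro k ⟨r, _, hr, _⟩
    simpa using Fintype.card_le_of_injective r hr

/-- If `H` has no `a × b` all-zero sub-stencil, then `vrk H < a + b`. -/
theorem stmt8 (m n a b : ℕ) (H : Matrix (Fin m) (Fin n) Bool)
    (h : ¬ ∃ (r : Fin a → Fin m) (c : Fin b → Fin n),
      Function.Injective r ∧ Function.Injective c ∧
        ∀ i j, H (r i) (c j) = false) :
    vrk H < a + b := by
  by_contra! hk
  obtain ⟨r, c, hr, hc, hM⟩ := exists_visFullRank_vrk H
  obtain ⟨r', c', hr', hc', hz⟩ := hM.exists_zero_substencil hk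
  exact h ⟨r ∘ r', c ∘ c', hr.comp hr', hc.comp hc', hz⟩
end
end

section
/- Let H be an m × n stencil whose visible rank is at most n − s, where 0 ≤ s ≤ n. Then for every natural number k ≥ 1, the visible rank of the k-th tensor power satisfies vrk(H^{⊗k}) ≤ (n − s/k)^k (as real numbers); equivalently, vrk(H^{⊗k})^{1/k} ≤ n − s/k. -/
noncomputable section

/-- A family of rows and columns whose identity diagonal is its only diagonal of stars bounds the
visible rank from below. -/
theorem card_le_vrk {α β ι : Type*} [Fintype ι] [DecidableEq ι] [Fintype β]
    (H : Matrix α β Bool) (r : ι → α) (c : ι → β) (hc : Function.Injective c)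
    (hd : ∀ i, H (r i) (c i) = true)
    (hu : ∀ σ : Equiv.Perm ι, (∀ i, H (r i) (c (σ i)) = true) → σ = 1) :
    Fintype.card ι ≤ vrk H := by
  have hr : Function.Injective r := by
    intro i j hij
    by_contra hne
    have h : Equiv.swap i j = 1 := by
      refine hu _ fun x => ?_
      rcases eq_or_ne x i with rfl | hxi
      · rw [Equiv.swap_apply_left, hij]
        exact hd j
      rcases eq_or_ne x j with rfl | hxj
      · rw [Equiv.swap_apply_right, ← hij]
        exact hd i
      · rw [Equiv.swap_apply_of_ne_of_ne hxi hxj]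
        exact hd x
    exact hne (Equiv.swap_eq_one_iff.mp h)
  let e := (Fintype.equivFin ι).symm
  refine le_csSup ⟨Fintype.card β, ?_⟩
    ⟨r ∘ e, c ∘ e, hr.comp e.injective, hc.comp e.injective, 1, fun i => hd (e i), ?_⟩
  · rintro k ⟨-, c', -, hc', -⟩
    simpa using Fintype.card_le_of_injective c' hc'
  · intro σ hσ
    have h := hu (e.permCongr σ) fun i => by simpa using hσ (e.symm i)
    ext i
    have := congrArg (fun τ => e.symm (τ (e i))) h
    simpa [Equiv.permCongr_apply] using congrArg Fin.val this

/-- Columns of a visibly full rank sub-stencil of `H^{⊗(k+1)}` that share their last `k`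
coordinates give a visibly full rank sub-stencil of `H`. -/
theorem vrk_stPow_succ_le {α β : Type*} [Fintype β] (H : Matrix α β Bool) (k : ℕ) :
    vrk (stPow H (k + 1)) ≤ vrk H * Fintype.card β ^ k := by
  classical
  refine csSup_le' ?_
  rintro N ⟨r, c, -, hc, σ₀, hσ₀, huniq⟩
  simp only [Matrix.of_apply, stPow, decide_eq_true_eq] at hσ₀ huniq
  let col : Fin N → Fin (k + 1) → β := c ∘ σ₀
  have hcol : Function.Injective col := hc.comp σ₀.injective
  have hfib (b : Fin k → β) :
      (Finset.univ.filter fun i => Fin.tail (col i) = b).card ≤ vrk H := by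
    rw [← Fintype.card_subtype]
    refine card_le_vrk H (fun i => r i.1 0) (fun i => col i.1 0) ?_ (fun i => hσ₀ i.1 0) ?_
    · rintro ⟨i, hi⟩ ⟨j, hj⟩ hij
      refine Subtype.ext (hcol ?_)
      rw [← Fin.cons_self_tail (col i), ← Fin.cons_self_tail (col j), hi, hj]
      exact congrArg (fun x => (Fin.cons x b : Fin (k + 1) → β)) hij
    · intro τ hτ
      have h : σ₀ * Equiv.Perm.ofSubtype τ = σ₀ := by
        refine huniq _ fun i => ?_
        by_cases hi : Fin.tail (col i) = b
        · rw [Equiv.Perm.mul_apply, Equiv.Perm.ofSubtype_apply_of_mem τ hi]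
          refine Fin.cases (hτ ⟨i, hi⟩) fun l => ?_
          have hl : c (σ₀ (τ ⟨i, hi⟩)) l.succ = c (σ₀ i) l.succ :=
            congrFun ((τ ⟨i, hi⟩).2.trans hi.symm) l
          rw [hl]
          exact hσ₀ i l.succ
        · rw [Equiv.Perm.mul_apply, Equiv.Perm.ofSubtype_apply_of_not_mem τ hi]
          exact hσ₀ i
      exact Equiv.Perm.ofSubtype_injective ((mul_eq_left.mp h).trans (map_one _).symm)
  have h := Finset.card_le_mul_card_image_of_maps_to
    (s := (Finset.univ : Finset (Fin N))) (t := Finset.univ) (f := fun i => Fin.tail (col i))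
    (fun _ _ => Finset.mem_univ _) (vrk H) fun b _ => hfib b
  simpa using h

/-- A form of Bernoulli's inequality. -/
theorem sub_mul_pow_le_sub_div_pow {n s : ℝ} (hs : 0 ≤ s) (hsn : s ≤ n) (k : ℕ) :
    (n - s) * n ^ k ≤ (n - s / (k + 1 : ℕ)) ^ (k + 1) := by
  rcases (hs.trans hsn).eq_or_lt with rfl | hn
  · obtain rfl : s = 0 := le_antisymm hsn hs
    simp
  have hk : (1 : ℝ) ≤ (k + 1 : ℕ) := by simp
  have hle : s / (n * (k + 1 : ℕ)) ≤ 1 :=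
    (div_le_one (by positivity)).mpr (hsn.trans (le_mul_of_one_le_right hn.le hk))
  have h := one_add_mul_le_pow (a := -(s / (n * (k + 1 : ℕ)))) (by linarith) (k + 1)
  calc (n - s) * n ^ k
      = n ^ (k + 1) * (1 + (k + 1 : ℕ) * -(s / (n * (k + 1 : ℕ)))) := by
        field_simp
        ring
    _ ≤ n ^ (k + 1) * (1 + -(s / (n * (k + 1 : ℕ)))) ^ (k + 1) := by gcongr
    _ = (n - s / (k + 1 : ℕ)) ^ (k + 1) := by
        rw [← mul_pow]
        congr 1
        field_simp
        ring

/-- If `vrk H ≤ n - s` then `vrk (H^{⊗k}) ≤ (n - s/k)^k`. -/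
theorem stmt17 (m n s : ℕ) (H : Matrix (Fin m) (Fin n) Bool) (hs : s ≤ n)
    (hvrk : (vrk H : ℝ) ≤ (n : ℝ) - (s : ℝ)) (k : ℕ) (hk : 1 ≤ k) :
    (vrk (stPow H k) : ℝ) ≤ ((n : ℝ) - (s : ℝ) / (k : ℝ)) ^ k := by
  obtain ⟨k, rfl⟩ := Nat.exists_eq_add_of_le' hk
  calc (vrk (stPow H (k + 1)) : ℝ)
      ≤ vrk H * (n : ℝ) ^ k := by
        exact_mod_cast (Fintype.card_fin n) ▸ vrk_stPow_succ_le H k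
    _ ≤ (n - s) * (n : ℝ) ^ k := by gcongr
    _ ≤ (n - s / (k + 1 : ℕ)) ^ (k + 1) :=
        sub_mul_pow_le_sub_div_pow s.cast_nonneg (Nat.cast_le.mpr hs) k
end
end
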